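/- arXiv:2605.00298 — 2 statements merged into one kernel-verified Lean document; each statement's English description precedes it below -/
import Mathlib

section
/- Suppose for each i ∈ {1,…,N} the curve w_i : [0,1] → ℝ^d is differentiable, satisfies ∇F_{S,t,i}(w_i(t)) = 0 for every t ∈ [0,1], and w_i(0) = ŵ where ŵ is the global minimizer of F_S. Let L : ℝ^d → ℝ be the C¹ test risk and set f_i(t) := L(w_i(t)). Then each f_i is differentiable at 0 with f_i'(0) = ⟨∇L(ŵ), H₀⁻¹ ∇ℓ_i(ŵ)⟩, and the average satisfies (1/N)·Σ_{i=1}^N f_i'(0) = −(λ/N)·D, where H₀ := ∇²F_S(ŵ) and D := ⟨∇L(ŵ), H₀⁻¹( −(1/λ)·Σ_{i=1}^N ∇ℓ_i(ŵ) )⟩. -/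
open scoped RealInnerProductSpace BigOperators

/-- The Hessian of `f : ℝ^d → ℝ` at `w`, viewed as a continuous linear map on `ℝ^d`,
obtained as the Fréchet derivative of the gradient map. -/
noncomputable def hessian {d : ℕ} (f : EuclideanSpace ℝ (Fin d) → ℝ)
    (w : EuclideanSpace ℝ (Fin d)) :
    EuclideanSpace ℝ (Fin d) →L[ℝ] EuclideanSpace ℝ (Fin d) :=
  fderiv ℝ (gradient f) w

/-- The regularized empirical risk `F_S(w) = ∑ i, ℓ_i(w) + λ · Reg(w)`. -/
noncomputable def FS {d N : ℕ} (l : Fin N → EuclideanSpace ℝ (Fin d) → ℝ)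
    (Reg : EuclideanSpace ℝ (Fin d) → ℝ) (lam : ℝ)
    (w : EuclideanSpace ℝ (Fin d)) : ℝ :=
  (∑ i, l i w) + lam * Reg w

/-- The deletion-path objective `F_{S,t,i}(w) = F_S(w) − t · ℓ_i(w)`. -/
noncomputable def FSt {d N : ℕ} (l : Fin N → EuclideanSpace ℝ (Fin d) → ℝ)
    (Reg : EuclideanSpace ℝ (Fin d) → ℝ) (lam : ℝ) (i : Fin N) (t : ℝ)
    (w : EuclideanSpace ℝ (Fin d)) : ℝ :=
  FS l Reg lam w - t * l i w

theorem aux_grad_contDiff {d : ℕ} {f : EuclideanSpace ℝ (Fin d) → ℝ} (hf : ContDiff ℝ 2 f) :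
    Differentiable ℝ (gradient f) := by
  have h1 : Differentiable ℝ (fderiv ℝ f) :=
    (hf.fderiv_right (m := 1) (by norm_num)).differentiable (by norm_num)
  exact ((InnerProductSpace.toDual ℝ
    (EuclideanSpace ℝ (Fin d))).symm.toContinuousLinearEquiv.differentiable).comp h1

theorem aux_isUnit {d : ℕ} (A : EuclideanSpace ℝ (Fin d) →L[ℝ] EuclideanSpace ℝ (Fin d))
    {α : ℝ} (hα : 0 < α) (h : ∀ v, α * ‖v‖ ^ 2 ≤ ⟪A v, v⟫) : IsUnit A := by
  rw [ContinuousLinearMap.isUnit_iff_bijective]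
  have hinj : Function.Injective (A : EuclideanSpace ℝ (Fin d) →ₗ[ℝ] EuclideanSpace ℝ (Fin d)) := by
    rw [injective_iff_map_eq_zero]
    intro v hv
    have h1 := h v
    have h2 : A v = 0 := hv
    rw [h2, inner_zero_left] at h1
    by_contra hne
    have : 0 < ‖v‖ := norm_pos_iff.mpr hne
    have : 0 < α * ‖v‖ ^ 2 := by positivity
    linarith
  exact ⟨hinj, LinearMap.injective_iff_surjective.mp hinj⟩

/-- each `f_i(t) = L(w_i(t))` is differentiable at `0` with
`f_i'(0) = ⟨∇L(ŵ), H₀⁻¹ ∇ℓ_i(ŵ)⟩`, and the average of these derivatives equals `−(λ/N)·D`. -/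
theorem stmt1 {d N : ℕ} (hd : 1 ≤ d) (hN : 1 ≤ N)
    (l : Fin N → EuclideanSpace ℝ (Fin d) → ℝ)
    (Reg : EuclideanSpace ℝ (Fin d) → ℝ)
    (L : EuclideanSpace ℝ (Fin d) → ℝ)
    (lam G H β βR α : ℝ) (hlam : 0 < lam) (hα : 0 < α)
    -- (A1) smooth losses
    (hl : ∀ i, ContDiff ℝ 2 (l i))
    (hlG : ∀ i w, ‖gradient (l i) w‖ ≤ G)
    (hlH : ∀ i w, ‖hessian (l i) w‖ ≤ H)
    (hlLip : ∀ i w v, ‖hessian (l i) w - hessian (l i) v‖ ≤ β * ‖w - v‖)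
    -- (A2) smooth regularizer
    (hReg : ContDiff ℝ 2 Reg)
    (hRegLip : ∀ w v, ‖hessian Reg w - hessian Reg v‖ ≤ βR * ‖w - v‖)
    -- (A3) strong convexity of every F_{S,t,i}
    (hSC : ∀ (i : Fin N) (t : ℝ), t ∈ Set.Icc (0 : ℝ) 1 →
      ∀ w v : EuclideanSpace ℝ (Fin d),
        α * ‖v‖ ^ 2 ≤ ⟪hessian (FSt l Reg lam i t) w v, v⟫)
    -- test risk is C¹
    (hL : ContDiff ℝ 1 L)
    -- the curves: differentiable, first-order optimal along the path, starting at ŵ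
    (what : EuclideanSpace ℝ (Fin d))
    (hmin : ∀ v, FS l Reg lam what ≤ FS l Reg lam v)
    (w : Fin N → ℝ → EuclideanSpace ℝ (Fin d))
    (w' : Fin N → ℝ → EuclideanSpace ℝ (Fin d))
    (hw : ∀ i, ∀ t ∈ Set.Icc (0 : ℝ) 1,
      HasDerivWithinAt (w i) (w' i t) (Set.Icc (0 : ℝ) 1) t)
    (hopt : ∀ i, ∀ t ∈ Set.Icc (0 : ℝ) 1, gradient (FSt l Reg lam i t) (w i t) = 0)
    (hw0 : ∀ i, w i 0 = what) :
    (∀ i : Fin N,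
      HasDerivWithinAt (fun t => L (w i t))
        ⟪gradient L what, Ring.inverse (hessian (FS l Reg lam) what) (gradient (l i) what)⟫
        (Set.Icc (0 : ℝ) 1) 0) ∧
    (1 / (N : ℝ)) * ∑ i : Fin N,
        ⟪gradient L what, Ring.inverse (hessian (FS l Reg lam) what) (gradient (l i) what)⟫
      = -(lam / (N : ℝ)) *
        ⟪gradient L what,
          Ring.inverse (hessian (FS l Reg lam) what)
            ((-(1 / lam)) • ∑ i : Fin N, gradient (l i) what)⟫ := by
  constructor
  · intro i
    have hFS : ContDiff ℝ 2 (FS l Reg lam) := by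
      unfold FS
      exact (ContDiff.sum fun i _ => hl i).add (contDiff_const.mul hReg)
    have h0 : (0 : ℝ) ∈ Set.Icc (0 : ℝ) 1 := by simp
    have hgrad : ∀ t x, gradient (FSt l Reg lam i t) x
        = gradient (FS l Reg lam) x - t • gradient (l i) x := by
      intro t x
      have e1 : HasFDerivAt (FS l Reg lam) (fderiv ℝ (FS l Reg lam) x) x :=
        ((hFS.differentiable (by norm_num)) x).hasFDerivAt
      have e2 : HasFDerivAt (l i) (fderiv ℝ (l i) x) x :=
        (((hl i).differentiable (by norm_num)) x).hasFDerivAt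
      have e3 : HasFDerivAt (FSt l Reg lam i t)
          (fderiv ℝ (FS l Reg lam) x - t • fderiv ℝ (l i) x) x := e1.sub (e2.const_mul t)
      unfold gradient
      rw [e3.fderiv, map_sub, map_smul]
    have hF0 : FSt l Reg lam i 0 = FS l Reg lam := by
      funext x; simp [FSt]
    have hU : IsUnit (hessian (FS l Reg lam) what) := by
      refine aux_isUnit _ hα fun v => ?_
      have := hSC i 0 h0 what v
      rwa [hF0] at this
    have hwd := hw i 0 h0
    have hg : HasFDerivAt (gradient (FS l Reg lam)) (hessian (FS l Reg lam) what) (w i 0) := by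
      rw [hw0]; exact (aux_grad_contDiff hFS what).hasFDerivAt
    have hgl : HasFDerivAt (gradient (l i)) (hessian (l i) what) (w i 0) := by
      rw [hw0]; exact (aux_grad_contDiff (hl i) what).hasFDerivAt
    have d1 := hg.comp_hasDerivWithinAt (0 : ℝ) hwd
    have d2 := hgl.comp_hasDerivWithinAt (0 : ℝ) hwd
    have d3 := d1.sub ((hasDerivWithinAt_id (0 : ℝ) (Set.Icc (0 : ℝ) 1)).smul d2)
    have d4 : HasDerivWithinAt (fun _ : ℝ => (0 : EuclideanSpace ℝ (Fin d))) _
        (Set.Icc (0 : ℝ) 1) 0 := d3.congr_of_mem (fun t ht => by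
      have := hopt i t ht
      rw [hgrad] at this
      simpa using this.symm) h0
    have huniq := (uniqueDiffOn_Icc (zero_lt_one' ℝ) 0 h0).eq_deriv _ d4
      (hasDerivWithinAt_const (0 : ℝ) _ _)
    have hw'eq : hessian (FS l Reg lam) what (w' i 0) = gradient (l i) what := by
      simp [hw0] at huniq
      exact sub_eq_zero.mp huniq
    have hinv : Ring.inverse (hessian (FS l Reg lam) what) (gradient (l i) what) = w' i 0 := by
      rw [← hw'eq, ← ContinuousLinearMap.mul_apply, Ring.inverse_mul_cancel _ hU]
      rfl
    rw [hinv]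
    have hLd : HasFDerivAt L (fderiv ℝ L what) (w i 0) := by
      rw [hw0]; exact ((hL.differentiable (by norm_num)) what).hasFDerivAt
    have := hLd.comp_hasDerivWithinAt (0 : ℝ) hwd
    have hi : ⟪gradient L what, w' i 0⟫ = fderiv ℝ L what (w' i 0) := by
      unfold gradient
      rw [InnerProductSpace.toDual_symm_apply]
    rw [hi]
    exact this
  · rw [map_smul, map_sum, inner_smul_right, inner_sum]
    field_simp
end

section
/- Fix i ∈ {1,…,N} and suppose w_i : [0,1] → ℝ^d is twice continuously differentiable with ∇F_{S,t,i}(w_i(t)) = 0 for every t ∈ [0,1]. Let L : ℝ^d → ℝ be the C² test risk and set f_i(t) := L(w_i(t)). Then for every t ∈ [0,1], |f_i''(t)| ≤ C, where C := 3HG²/α² + β̄G³/α³ and β̄ := N·β + λ·β_R. -/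
open scoped RealInnerProductSpace BigOperators

theorem grad_contDiff {d : ℕ} {f : EuclideanSpace ℝ (Fin d) → ℝ} {n m : WithTop ℕ∞}
    (hf : ContDiff ℝ n f) (h : m + 1 ≤ n) : ContDiff ℝ m (gradient f) := by
  have h1 : ContDiff ℝ m (fderiv ℝ f) := hf.fderiv_right h
  exact ((InnerProductSpace.toDual ℝ (EuclideanSpace ℝ (Fin d))).symm.toContinuousLinearEquiv.contDiff).comp h1

theorem grad_FSt {d N : ℕ} {l : Fin N → EuclideanSpace ℝ (Fin d) → ℝ}
    {Reg : EuclideanSpace ℝ (Fin d) → ℝ} (lam : ℝ) (i : Fin N) (t : ℝ)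
    (hl : ∀ i, ContDiff ℝ 3 (l i)) (hReg : ContDiff ℝ 3 Reg) :
    gradient (FSt l Reg lam i t) = fun w =>
      ((∑ j, gradient (l j) w) + lam • gradient Reg w) - t • gradient (l i) w := by
  funext w
  have hj : ∀ j, HasFDerivAt (l j) (fderiv ℝ (l j) w) w := fun j =>
    ((hl j).differentiable (by norm_num) w).hasFDerivAt
  have hR : HasFDerivAt Reg (fderiv ℝ Reg w) w :=
    (hReg.differentiable (by norm_num) w).hasFDerivAt
  have h : HasFDerivAt (FSt l Reg lam i t)
      (((∑ j, fderiv ℝ (l j) w) + lam • fderiv ℝ Reg w) - t • fderiv ℝ (l i) w) w :=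
    ((HasFDerivAt.fun_sum (fun j _ => hj j)).add (hR.const_mul lam)).sub ((hj i).const_mul t)
  unfold gradient
  rw [h.fderiv]
  simp [map_sum]

theorem hess_FSt {d N : ℕ} {l : Fin N → EuclideanSpace ℝ (Fin d) → ℝ}
    {Reg : EuclideanSpace ℝ (Fin d) → ℝ} (lam : ℝ) (i : Fin N) (t : ℝ)
    (hl : ∀ i, ContDiff ℝ 3 (l i)) (hReg : ContDiff ℝ 3 Reg) :
    hessian (FSt l Reg lam i t) = fun w =>
      ((∑ j, hessian (l j) w) + lam • hessian Reg w) - t • hessian (l i) w := by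
  funext w
  have hj : ∀ j, HasFDerivAt (gradient (l j)) (hessian (l j) w) w := fun j =>
    ((grad_contDiff (m := 2) (hl j) (by norm_num)).differentiable (by norm_num) w).hasFDerivAt
  have hR : HasFDerivAt (gradient Reg) (hessian Reg w) w :=
    ((grad_contDiff (m := 2) hReg (by norm_num)).differentiable (by norm_num) w).hasFDerivAt
  have h := ((HasFDerivAt.fun_sum (u := Finset.univ) (fun j _ => hj j)).add (hR.const_smul lam)).sub
    ((hj i).const_smul t)
  rw [hessian, grad_FSt lam i t hl hReg]
  exact h.fderiv

theorem hess_contDiff {d : ℕ} {f : EuclideanSpace ℝ (Fin d) → ℝ}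
    (hf : ContDiff ℝ 3 f) : ContDiff ℝ 1 (hessian f) :=
  (grad_contDiff (m := 2) hf (by norm_num)).fderiv_right (by norm_num)

/-- `f_i(t) = L(w_i(t))` is twice differentiable along the path, and its second
derivative satisfies `|f_i''(t)| ≤ C` with `C = 3HG²/α² + β̄G³/α³`, `β̄ = N·β + λ·β_R`. -/
theorem stmt6 {d N : ℕ} (hd : 1 ≤ d) (hN : 1 ≤ N)
    (l : Fin N → EuclideanSpace ℝ (Fin d) → ℝ)
    (Reg : EuclideanSpace ℝ (Fin d) → ℝ)
    (L : EuclideanSpace ℝ (Fin d) → ℝ)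
    (lam G H β βR α : ℝ) (hlam : 0 < lam) (hα : 0 < α)
    -- (A1) smooth losses (C³)
    (hl : ∀ i, ContDiff ℝ 3 (l i))
    (hlG : ∀ i w, ‖gradient (l i) w‖ ≤ G)
    (hlH : ∀ i w, ‖hessian (l i) w‖ ≤ H)
    (hlLip : ∀ i w v, ‖hessian (l i) w - hessian (l i) v‖ ≤ β * ‖w - v‖)
    -- (A2) smooth regularizer (C³)
    (hReg : ContDiff ℝ 3 Reg)
    (hRegLip : ∀ w v, ‖hessian Reg w - hessian Reg v‖ ≤ βR * ‖w - v‖)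
    -- (A3) strong convexity of every F_{S,t,i}
    (hSC : ∀ (i : Fin N) (t : ℝ), t ∈ Set.Icc (0 : ℝ) 1 →
      ∀ w v : EuclideanSpace ℝ (Fin d),
        α * ‖v‖ ^ 2 ≤ ⟪hessian (FSt l Reg lam i t) w v, v⟫)
    -- test risk is C² with bounded gradient and Hessian
    (hL : ContDiff ℝ 2 L)
    (hLG : ∀ w, ‖gradient L w‖ ≤ G)
    (hLH : ∀ w, ‖hessian L w‖ ≤ H)
    -- the curve: twice continuously differentiable, first-order optimal along the path
    (i : Fin N) (w w' w'' : ℝ → EuclideanSpace ℝ (Fin d))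
    (hw : ∀ t ∈ Set.Icc (0 : ℝ) 1, HasDerivWithinAt w (w' t) (Set.Icc (0 : ℝ) 1) t)
    (hw' : ∀ t ∈ Set.Icc (0 : ℝ) 1, HasDerivWithinAt w' (w'' t) (Set.Icc (0 : ℝ) 1) t)
    (hw'' : ContinuousOn w'' (Set.Icc (0 : ℝ) 1))
    (hopt : ∀ t ∈ Set.Icc (0 : ℝ) 1, gradient (FSt l Reg lam i t) (w t) = 0) :
    ∃ f' f'' : ℝ → ℝ,
      (∀ t ∈ Set.Icc (0 : ℝ) 1,
        HasDerivWithinAt (fun s => L (w s)) (f' t) (Set.Icc (0 : ℝ) 1) t) ∧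
      (∀ t ∈ Set.Icc (0 : ℝ) 1,
        HasDerivWithinAt f' (f'' t) (Set.Icc (0 : ℝ) 1) t) ∧
      (∀ t ∈ Set.Icc (0 : ℝ) 1,
        |f'' t| ≤ 3 * H * G ^ 2 / α ^ 2 + ((N : ℝ) * β + lam * βR) * G ^ 3 / α ^ 3) := by
  have hu : ∀ t ∈ Set.Icc (0 : ℝ) 1, UniqueDiffWithinAt ℝ (Set.Icc (0 : ℝ) 1) t :=
    uniqueDiffOn_Icc (by norm_num)
  have hgd : ∀ (f : EuclideanSpace ℝ (Fin d) → ℝ), ContDiff ℝ 2 f → ∀ t ∈ Set.Icc (0 : ℝ) 1,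
      HasDerivWithinAt (fun s => gradient f (w s)) (hessian f (w t) (w' t))
        (Set.Icc (0 : ℝ) 1) t := by
    intro f hf t ht
    have h : HasFDerivAt (gradient f) (hessian f (w t)) (w t) :=
      ((grad_contDiff (m := 1) hf (by norm_num)).differentiable (by norm_num) _).hasFDerivAt
    exact h.comp_hasDerivWithinAt t (hw t ht)
  have hl2 : ∀ j, ContDiff ℝ 2 (l j) := fun j => (hl j).of_le (by norm_num)
  have hFt : ∀ t, ContDiff ℝ 3 (FSt l Reg lam i t) := by
    intro t
    exact ((ContDiff.sum (fun j _ => hl j)).add (contDiff_const.mul hReg)).sub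
      (contDiff_const.mul (hl i))
  -- relation between different parameters
  have hgs : ∀ s t x, gradient (FSt l Reg lam i s) x
      = gradient (FSt l Reg lam i t) x - (s - t) • gradient (l i) x := by
    intro s t x
    rw [grad_FSt lam i s hl hReg, grad_FSt lam i t hl hReg]
    simp only [sub_smul]; abel
  have hhs : ∀ s t x, hessian (FSt l Reg lam i s) x
      = hessian (FSt l Reg lam i t) x - (s - t) • hessian (l i) x := by
    intro s t x
    rw [hess_FSt lam i s hl hReg, hess_FSt lam i t hl hReg]
    module
  have hid : ∀ t : ℝ, HasDerivWithinAt (fun s : ℝ => s - t) 1 (Set.Icc (0 : ℝ) 1) t :=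
    fun t => ((hasDerivAt_id t).sub_const t).hasDerivWithinAt
  -- first order relation
  have h1 : ∀ t ∈ Set.Icc (0 : ℝ) 1,
      hessian (FSt l Reg lam i t) (w t) (w' t) = gradient (l i) (w t) := by
    intro t ht
    have ha := (hgd _ ((hFt t).of_le (by norm_num)) t ht).sub
      ((hid t).smul (hgd _ (hl2 i) t ht))
    have hb : HasDerivWithinAt (fun _ : ℝ => (0 : EuclideanSpace ℝ (Fin d))) 0
      (Set.Icc (0 : ℝ) 1) t := hasDerivWithinAt_const _ _ _
    have hc := (hu t ht).eq_deriv _ ha (hb.congr (fun s hs => by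
      have := hopt s hs
      rw [hgs s t] at this
      exact this) (by
      have := hopt t ht
      rw [hgs t t] at this
      exact this))
    simpa [sub_eq_zero] using hc
  have h2 : ∀ t ∈ Set.Icc (0 : ℝ) 1,
      hessian (FSt l Reg lam i t) (w t) (w'' t) =
        (2 : ℝ) • hessian (l i) (w t) (w' t)
        - (fderiv ℝ (hessian (FSt l Reg lam i t)) (w t) (w' t)) (w' t) := by
    intro t ht
    have hK : ∀ f : EuclideanSpace ℝ (Fin d) → ℝ, ContDiff ℝ 3 f →
        HasDerivWithinAt (fun s => hessian f (w s) (w' s))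
          ((fderiv ℝ (hessian f) (w t) (w' t)) (w' t) + hessian f (w t) (w'' t))
          (Set.Icc (0 : ℝ) 1) t := by
      intro f hf
      have h : HasFDerivAt (hessian f) (fderiv ℝ (hessian f) (w t)) (w t) :=
        ((hess_contDiff hf).differentiable (by norm_num) _).hasFDerivAt
      exact (h.comp_hasDerivWithinAt t (hw t ht)).clm_apply (hw' t ht)
    have ha := (hK _ (hFt t)).sub ((hid t).smul (hK _ (hl i)))
    have hrel : ∀ s ∈ Set.Icc (0 : ℝ) 1, gradient (l i) (w s) =
        hessian (FSt l Reg lam i t) (w s) (w' s) - (s - t) • hessian (l i) (w s) (w' s) := by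
      intro s hs
      rw [← h1 s hs, hhs s t]
      simp
    have hc := (hu t ht).eq_deriv _ (ha.congr hrel (hrel t ht)) (hgd _ (hl2 i) t ht)
    simp only [sub_self, zero_smul, one_smul, zero_add] at hc
    rw [two_smul, eq_sub_iff_add_eq]
    nth_rewrite 1 [← hc]
    abel
  have hβ : 0 ≤ β := by
    have := hlLip i (EuclideanSpace.single ⟨0, hd⟩ 1) 0
    simp only [sub_zero, EuclideanSpace.norm_single, norm_one, mul_one] at this
    exact (norm_nonneg _).trans this
  have hβR : 0 ≤ βR := by
    have := hRegLip (EuclideanSpace.single ⟨0, hd⟩ 1) 0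
    simp only [sub_zero, EuclideanSpace.norm_single, norm_one, mul_one] at this
    exact (norm_nonneg _).trans this
  have hG : 0 ≤ G := (norm_nonneg _).trans (hLG 0)
  have hH : 0 ≤ H := (norm_nonneg _).trans (hLH 0)
  set B := (N : ℝ) * β + lam * βR with hB
  have hB0 : 0 ≤ B := by positivity
  have hLipB : ∀ t ∈ Set.Icc (0 : ℝ) 1, ∀ x y,
      ‖hessian (FSt l Reg lam i t) x - hessian (FSt l Reg lam i t) y‖ ≤ B * ‖x - y‖ := by
    intro t ht x y
    have e : hessian (FSt l Reg lam i t) x - hessian (FSt l Reg lam i t) y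
        = (∑ j ∈ Finset.univ.erase i, (hessian (l j) x - hessian (l j) y))
          + (1 - t) • (hessian (l i) x - hessian (l i) y)
          + lam • (hessian Reg x - hessian Reg y) := by
      rw [hess_FSt lam i t hl hReg]
      simp only [Finset.sum_sub_distrib]
      rw [← Finset.add_sum_erase _ (fun j => hessian (l j) x) (Finset.mem_univ i),
        ← Finset.add_sum_erase _ (fun j => hessian (l j) y) (Finset.mem_univ i)]
      simp only [sub_smul, smul_sub, one_smul]
      abel
    have b1 : ‖∑ j ∈ Finset.univ.erase i, (hessian (l j) x - hessian (l j) y)‖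
        ≤ ((N : ℝ) - 1) * (β * ‖x - y‖) := by
      refine (norm_sum_le_of_le _ (fun j _ => hlLip j x y)).trans (le_of_eq ?_)
      rw [Finset.sum_const, Finset.card_erase_of_mem (Finset.mem_univ i), Finset.card_univ,
        Fintype.card_fin, nsmul_eq_mul, Nat.cast_sub hN, Nat.cast_one]
    have b2 : ‖(1 - t) • (hessian (l i) x - hessian (l i) y)‖ ≤ 1 * (β * ‖x - y‖) := by
      rw [norm_smul, Real.norm_of_nonneg (by linarith [ht.2])]
      exact mul_le_mul (by linarith [ht.1]) (hlLip i x y) (norm_nonneg _) zero_le_one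
    have b3 : ‖lam • (hessian Reg x - hessian Reg y)‖ ≤ lam * (βR * ‖x - y‖) := by
      rw [norm_smul, Real.norm_of_nonneg hlam.le]
      exact mul_le_mul_of_nonneg_left (hRegLip x y) hlam.le
    rw [e]
    refine norm_add₃_le.trans ?_
    rw [hB]
    linarith
  have hinv : ∀ t ∈ Set.Icc (0 : ℝ) 1, ∀ x v,
      ‖v‖ ≤ ‖hessian (FSt l Reg lam i t) x v‖ / α := by
    intro t ht x v
    rw [le_div_iff₀ hα]
    have ha := (hSC i t ht x v).trans (real_inner_le_norm _ _)
    rcases (norm_nonneg v).eq_or_lt with h0 | h0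
    · rw [← h0]; simp
    · refine le_of_mul_le_mul_right ?_ h0
      linarith
  refine ⟨fun t => ⟪gradient L (w t), w' t⟫,
    fun t => ⟪gradient L (w t), w'' t⟫ + ⟪hessian L (w t) (w' t), w' t⟫, ?_, ?_, ?_⟩
  · intro t ht
    have h : HasFDerivAt L (fderiv ℝ L (w t)) (w t) :=
      (hL.differentiable (by norm_num) _).hasFDerivAt
    have h' := h.comp_hasDerivWithinAt t (hw t ht)
    have e : fderiv ℝ L (w t) (w' t) = ⟪gradient L (w t), w' t⟫ := by
      simp [gradient]
    rw [e] at h'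
    exact h'
  · intro t ht
    exact (hgd L hL t ht).inner ℝ (hw' t ht)
  · intro t ht
    have n1 : ‖w' t‖ ≤ G / α := by
      refine (hinv t ht (w t) (w' t)).trans ?_
      rw [h1 t ht]
      gcongr
      exact hlG i _
    have nD : ‖fderiv ℝ (hessian (FSt l Reg lam i t)) (w t)‖ ≤ B :=
      norm_fderiv_le_of_lip' ℝ hB0 (Filter.Eventually.of_forall fun x => hLipB t ht x (w t))
    have nHw : ‖hessian (l i) (w t) (w' t)‖ ≤ H * (G / α) :=
      (hessian (l i) (w t)).le_of_opNorm_le_of_le (hlH i _) n1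
    have nT : ‖(fderiv ℝ (hessian (FSt l Reg lam i t)) (w t) (w' t)) (w' t)‖
        ≤ B * (G / α) * (G / α) :=
      ContinuousLinearMap.le_of_opNorm_le_of_le _
        (ContinuousLinearMap.le_of_opNorm_le_of_le _ nD n1) n1
    have n2 : ‖w'' t‖ ≤ (2 * (H * (G / α)) + B * (G / α) * (G / α)) / α := by
      refine (hinv t ht (w t) (w'' t)).trans ?_
      rw [h2 t ht]
      gcongr
      refine (norm_sub_le _ _).trans (add_le_add ?_ nT)
      rw [norm_smul, Real.norm_of_nonneg (by norm_num)]
      linarith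
    have i1 : |⟪gradient L (w t), w'' t⟫| ≤
        G * ((2 * (H * (G / α)) + B * (G / α) * (G / α)) / α) :=
      (abs_real_inner_le_norm _ _).trans (mul_le_mul (hLG _) n2 (norm_nonneg _) hG)
    have i2 : |⟪hessian L (w t) (w' t), w' t⟫| ≤ H * (G / α) * (G / α) :=
      (abs_real_inner_le_norm _ _).trans (mul_le_mul
        (ContinuousLinearMap.le_of_opNorm_le_of_le _ (hLH _) n1) n1 (norm_nonneg _)
        (by positivity))
    refine (abs_add_le _ _).trans ((add_le_add i1 i2).trans (le_of_eq ?_))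
    field_simp
    ring
end
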